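/- Let G be a finite simple graph with edge weights cost : E(G) → ℕ, let Z ⊆ V(G) be nonempty, and let ℬ be a finite set of subgraphs of G. Then there exists a set ℛ ⊆ ℬ with |ℛ| ≤ 2^{|Z|−1} such that ℛ represents ℬ on Z. -/

import Mathlib

/-- The cost of a subgraph: the sum of the weights of its edges. -/
noncomputable def subCost {V : Type} [Fintype V] {G : SimpleGraph V}
    (cost : Sym2 V → ℕ) (H : G.Subgraph) : ℕ :=
  ∑ e ∈ H.edgeSet.toFinite.toFinset, cost e

/-- The partition `π_F(X)` of `X` induced by a subgraph `F`, encoded as an equivalence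
relation (= setoid) on `X`: vertices of `X` outside `V(F)` are singleton blocks, and two
vertices of `X ∩ V(F)` lie in the same block iff they lie in the same connected component
of `F`. -/
def piF {V : Type} {G : SimpleGraph V} (F : G.Subgraph) (X : Set V) : Setoid X where
  r u v := u = v ∨ ((u : V) ∈ F.verts ∧ (v : V) ∈ F.verts ∧
    F.spanningCoe.Reachable (u : V) (v : V))
  iseqv := by
    constructor
    · intro u; exact Or.inl rfl
    · rintro u v (rfl | ⟨hu, hv, h⟩)
      · exact Or.inl rfl
      · exact Or.inr ⟨hv, hu, h.symm⟩
    · rintro u v w (rfl | ⟨hu, hv, h⟩) h'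
      · exact h'
      · rcases h' with (rfl | ⟨hv', hw, h'⟩)
        · exact Or.inr ⟨hu, hv, h⟩
        · exact Or.inr ⟨hu, hw, h.trans h'⟩

/-- A family `R` of subgraphs *represents* a family `B` on `Z` if for every partition `Q`
of `Z` (encoded as a setoid), the minimum cost of a member `F` with `π_F(Z) ⊔ Q = {Z}`
(the join being taken in the partition lattice, and `{Z}` being the one-block partition,
i.e. `⊤`) is the same over `B` as over `R`; minima are taken in `ℕ∪{∞}` with `min ∅ = ∞`. -/
def RepresentsOn {V : Type} [Fintype V] {G : SimpleGraph V} (cost : Sym2 V → ℕ)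
    (Z : Set V) (B R : Set G.Subgraph) : Prop :=
  ∀ Q : Setoid Z,
    sInf {w : ℕ∞ | ∃ F ∈ B, piF F Z ⊔ Q = ⊤ ∧ w = (subCost cost F : ℕ∞)} =
    sInf {w : ℕ∞ | ∃ F ∈ R, piF F Z ⊔ Q = ⊤ ∧ w = (subCost cost F : ℕ∞)}

/-- A greedy minimum-weight basis: a finite family of vectors contains a linearly independent
subfamily such that every vector is spanned by chosen vectors of no larger weight. -/
theorem exists_linearIndepOn_span_le {K M α : Type*} [DivisionRing K] [AddCommGroup M]
    [Module K M] [DecidableEq α] (v : α → M) (c : α → ℕ) (s : Finset α) :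
    ∃ R ⊆ s, LinearIndepOn K v (R : Set α) ∧
      ∀ a ∈ s, v a ∈ Submodule.span K (v '' {b | b ∈ R ∧ c b ≤ c a}) := by
  induction s using Finset.induction_on_max_value c with
  | empty => exact ⟨∅, subset_rfl, by simp, by simp⟩
  | insert a s ha hmax ih =>
    obtain ⟨R, hRs, hR, hspan⟩ := ih
    by_cases hva : v a ∈ Submodule.span K (v '' (R : Set α))
    · refine ⟨R, hRs.trans (Finset.subset_insert _ _), hR, fun b hb => ?_⟩
      rcases Finset.mem_insert.1 hb with rfl | hb
      · refine Submodule.span_mono (Set.image_mono ?_) hva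
        exact fun x hx => ⟨hx, hmax x (hRs hx)⟩
      · exact hspan b hb
    · refine ⟨insert a R, Finset.insert_subset_insert _ hRs, ?_, fun b hb => ?_⟩
      · rw [Finset.coe_insert]
        exact hR.insert hva
      · rcases Finset.mem_insert.1 hb with rfl | hb
        · exact Submodule.subset_span ⟨b, ⟨Finset.mem_insert_self _ _, le_rfl⟩, rfl⟩
        · refine Submodule.span_mono (Set.image_mono ?_) (hspan b hb)
          exact fun x hx => ⟨Finset.mem_insert_of_mem hx.1, hx.2⟩

/-- The set `S` is a union of blocks of the partition `P`. -/
def Setoid.Saturates {U : Type*} (P : Setoid U) (S : Finset U) : Prop :=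
  ∀ u v, P u v → (u ∈ S ↔ v ∈ S)

theorem Setoid.saturates_sup {U : Type*} {P Q : Setoid U} {S : Finset U} :
    (P ⊔ Q).Saturates S ↔ P.Saturates S ∧ Q.Saturates S := by
  have key : ∀ R : Setoid U, R.Saturates S ↔ R ≤ Setoid.ker (· ∈ S) := fun R =>
    ⟨fun h u v huv => propext (h u v huv), fun h u v huv => iff_of_eq (h huv)⟩
  simp only [key, sup_le_iff]

open Classical in
/-- The number of saturated sets avoiding a fixed point is odd exactly for the one-block
partition. -/
theorem Setoid.sum_saturates_eq {U : Type*} [Fintype U] (u₀ : U) (R : Setoid U) :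
    ∑ S ∈ (Finset.univ.erase u₀).powerset, (if R.Saturates S then 1 else 0 : ZMod 2) =
      if R = ⊤ then 1 else 0 := by
  split_ifs with hR
  · subst hR
    rw [Finset.sum_eq_single_of_mem ∅ (Finset.empty_mem_powerset _)]
    · simp [Setoid.Saturates]
    · intro S hS hne
      obtain ⟨x, hx⟩ := Finset.nonempty_iff_ne_empty.2 hne
      refine if_neg fun h => ?_
      have h₀ := (h x u₀ trivial).1 hx
      simpa using Finset.mem_powerset.1 hS h₀
  · obtain ⟨w, hw⟩ : ∃ w, ¬ R w u₀ := by
      by_contra! h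
      exact hR (Setoid.eq_top_iff.2 fun x y => R.trans (h x) (R.symm (h y)))
    let C : Finset U := Finset.univ.filter fun x => R x w
    have hC : R.Saturates C := fun u v huv => by
      simp only [C, Finset.mem_filter, Finset.mem_univ, true_and]
      exact ⟨fun h => R.trans (R.symm huv) h, fun h => R.trans huv h⟩
    have hadd : ∀ S, R.Saturates S → R.Saturates (symmDiff S C) := fun S hS u v huv => by
      simp only [Finset.mem_symmDiff, hS u v huv, hC u v huv]
    have hiff : ∀ S, R.Saturates (symmDiff S C) ↔ R.Saturates S := fun S =>
      ⟨fun h => by simpa [symmDiff_assoc] using hadd _ h, hadd S⟩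
    refine Finset.sum_involution (fun S _ => symmDiff S C) ?_ ?_ ?_ ?_
    · intro S _
      simp only [hiff]
      exact CharTwo.add_self_eq_zero _
    · intro S _ _ h
      have hw' : w ∈ C := by simp [C]
      have := symmDiff_eq_left.1 h
      simp [this] at hw'
    · intro S hS
      have h₁ : u₀ ∉ S := fun h => by simpa using Finset.mem_powerset.1 hS h
      have h₂ : u₀ ∉ C := by
        simp only [C, Finset.mem_filter, Finset.mem_univ, true_and]
        exact fun h => hw (R.symm h)
      rw [Finset.mem_powerset]
      intro x hx
      refine Finset.mem_erase.2 ⟨?_, Finset.mem_univ _⟩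
      rintro rfl
      simp [Finset.mem_symmDiff, h₁, h₂] at hx
    · intro S _
      simp

open Classical in
/-- The vector over `ZMod 2` recording which sets avoiding `u₀` are saturated for `P`. -/
noncomputable def Setoid.cutVector {U : Type*} [Fintype U] (u₀ : U) (P : Setoid U) :
    (Finset.univ.erase u₀).powerset → ZMod 2 :=
  fun S => if P.Saturates S then 1 else 0

open Classical in
/-- The join matrix of the partition lattice factors through the cut vectors. -/
theorem Setoid.cutVector_dotProduct {U : Type*} [Fintype U] (u₀ : U) (P Q : Setoid U) :
    P.cutVector u₀ ⬝ᵥ Q.cutVector u₀ = if P ⊔ Q = ⊤ then 1 else 0 := by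
  rw [← Setoid.sum_saturates_eq u₀, ← Finset.sum_coe_sort]
  refine Finset.sum_congr rfl fun S _ => ?_
  simp only [Setoid.cutVector, Setoid.saturates_sup, ite_and]
  split_ifs <;> simp

/-- Among finitely many weighted partitions of a finite nonempty set `U`, at most
`2 ^ (|U| - 1)` of them suffice to complete every partition at minimum weight. -/
theorem exists_small_representatives {U α : Type*} [Fintype U] [Nonempty U]
    (p : α → Setoid U) (c : α → ℕ) (s : Finset α) :
    ∃ R ⊆ s, R.card ≤ 2 ^ (Fintype.card U - 1) ∧
      ∀ Q, ∀ a ∈ s, p a ⊔ Q = ⊤ → ∃ b ∈ R, c b ≤ c a ∧ p b ⊔ Q = ⊤ := by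
  classical
  obtain ⟨u₀⟩ := ‹Nonempty U›
  obtain ⟨R, hRs, hR, hspan⟩ :=
    exists_linearIndepOn_span_le (K := ZMod 2) (fun a => (p a).cutVector u₀) c s
  refine ⟨R, hRs, ?_, fun Q a ha hQ => ?_⟩
  · have := LinearIndependent.fintype_card_le_finrank hR
    rw [Module.finrank_fintype_fun_eq_card, Fintype.card_coe, Finset.card_powerset,
      Finset.card_erase_of_mem (Finset.mem_univ _), Finset.card_univ] at this
    simpa using this
  · by_contra! h
    have hzero : ∀ x ∈ Submodule.span (ZMod 2)
        ((fun a => (p a).cutVector u₀) '' {b | b ∈ R ∧ c b ≤ c a}),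
        x ⬝ᵥ Q.cutVector u₀ = 0 := by
      intro x hx
      induction hx using Submodule.span_induction with
      | mem x hx =>
        obtain ⟨b, ⟨hb, hba⟩, rfl⟩ := hx
        simp [Setoid.cutVector_dotProduct, h b hb hba]
      | zero => simp
      | add x y _ _ hx hy => rw [add_dotProduct, hx, hy, add_zero]
      | smul t x _ hx => rw [smul_dotProduct, hx, smul_zero]
    have := hzero _ (hspan a ha)
    simp [Setoid.cutVector_dotProduct, hQ] at this

/-- For any nonempty `Z ⊆ V(G)` and any finite family `ℬ` of subgraphs of
`G`, there is `ℛ ⊆ ℬ` with `|ℛ| ≤ 2^{|Z|−1}` representing `ℬ` on `Z`. -/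
theorem statement8 {V : Type} [Fintype V] [DecidableEq V] (G : SimpleGraph V)
    (cost : Sym2 V → ℕ) (Z : Finset V) (hZ : Z.Nonempty)
    (B : Set G.Subgraph) (hB : B.Finite) :
    ∃ R ⊆ B, R.Finite ∧ R.ncard ≤ 2 ^ (Z.card - 1) ∧
      RepresentsOn cost (↑Z : Set V) B R := by
  have : Nonempty (Z : Set V) := hZ.to_subtype
  obtain ⟨R, hRB, hcard, hR⟩ := exists_small_representatives
    (fun F : G.Subgraph => piF F (Z : Set V)) (subCost cost) hB.toFinset
  have hRB' : (R : Set G.Subgraph) ⊆ B := fun F hF => hB.mem_toFinset.1 (hRB hF)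
  refine ⟨R, hRB', R.finite_toSet, ?_, fun Q => le_antisymm ?_ ?_⟩
  · rw [Set.ncard_coe_finset]
    simpa using hcard
  · refine sInf_le_sInf ?_
    rintro w ⟨F, hF, h⟩
    exact ⟨F, hRB' hF, h⟩
  · refine le_sInf ?_
    rintro w ⟨F, hF, hFQ, rfl⟩
    obtain ⟨F', hF', hle, hQ'⟩ := hR Q F (hB.mem_toFinset.2 hF) hFQ
    exact le_trans (sInf_le ⟨F', hF', hQ', rfl⟩) (Nat.cast_le.2 hle)
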